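/- Let p ≥ 3 be a prime, let b, ε be integers with 0 ≤ b ≤ p − 2 and 0 ≤ ε ≤ p − 1, set n = bp + ε, and let m ≥ 1 be an integer. Then Σ_{k=0}^{b} (−1)^{n − kp} · (k^m / (b + 1 − k)) · C(n, kp) ≡ ((−1)^n / (b+1)) · (−1)^{b+1} · [ (b+1)!·{m brace b+1} + p·H_ε·(b+1)!·{m+1 brace b+1} − (b+1)^m − p·H_ε·(b+1)^{m+1} ] mod p², as rational numbers. -/

import Mathlib

/-- Congruence of rational numbers modulo `p^k`. -/
def RatCong (p k : ℕ) (x y : ℚ) : Prop :=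
  x = y ∨ (k : ℤ) ≤ padicValRat p (x - y)

/-- Stirling number of the second kind `{t brace s}` (with the convention `0^0 = 1`),
viewed as a rational number. -/
def stir (t s : ℕ) : ℚ :=
  (1 / (Nat.factorial s : ℚ)) *
    ∑ j ∈ Finset.range (s + 1), (-1 : ℚ) ^ j * (s.choose j : ℚ) * ((s - j : ℕ) : ℚ) ^ t

/-- `x` is `p^k` times a `p`-integral rational. -/
def PDiv (p k : ℕ) (x : ℚ) : Prop :=
  ∃ a d : ℤ, ¬ ((p : ℤ) ∣ d) ∧ x * d = (p : ℚ) ^ k * a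

theorem PDiv.add {p k : ℕ} (hp : p.Prime) {x y : ℚ} (hx : PDiv p k x) (hy : PDiv p k y) :
    PDiv p k (x + y) := by
  obtain ⟨a, d, hd, h⟩ := hx
  obtain ⟨a', d', hd', h'⟩ := hy
  refine ⟨a * d' + a' * d, d * d', ?_, ?_⟩
  · intro hh
    rcases (Nat.prime_iff_prime_int.mp hp).dvd_or_dvd hh with h1 | h1
    · exact hd h1
    · exact hd' h1
  · push_cast
    linear_combination (d' : ℚ) * h + (d : ℚ) * h'

theorem PDiv.mul {p k l : ℕ} (hp : p.Prime) {x y : ℚ} (hx : PDiv p k x) (hy : PDiv p l y) :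
    PDiv p (k + l) (x * y) := by
  obtain ⟨a, d, hd, h⟩ := hx
  obtain ⟨a', d', hd', h'⟩ := hy
  refine ⟨a * a', d * d', ?_, ?_⟩
  · intro hh
    rcases (Nat.prime_iff_prime_int.mp hp).dvd_or_dvd hh with h1 | h1
    · exact hd h1
    · exact hd' h1
  · push_cast
    rw [pow_add]
    linear_combination (y * d' : ℚ) * h + ((p : ℚ) ^ k * a) * h'

theorem PDiv.int {p : ℕ} (hp : p.Prime) (z : ℤ) : PDiv p 0 (z : ℚ) := by
  refine ⟨z, 1, ?_, by simp⟩
  intro h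
  exact (Nat.prime_iff_prime_int.mp hp).not_dvd_one h

theorem PDiv.inv {p : ℕ} (z : ℤ) (h : ¬ ((p : ℤ) ∣ z)) : PDiv p 0 ((z : ℚ)⁻¹) := by
  refine ⟨1, z, h, ?_⟩
  have : (z : ℚ) ≠ 0 := by
    intro h0
    apply h
    have : z = 0 := by exact_mod_cast h0
    simp [this]
  simp [this]

theorem PDiv.sum {p k : ℕ} (hp : p.Prime) (s : Finset ℕ) (f : ℕ → ℚ)
    (h : ∀ i ∈ s, PDiv p k (f i)) : PDiv p k (∑ i ∈ s, f i) := by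
  induction s using Finset.induction_on with
  | empty => exact ⟨0, 1, (Nat.prime_iff_prime_int.mp hp).not_dvd_one, by simp⟩
  | insert a s ha ih =>
    rw [Finset.sum_insert ha]
    exact PDiv.add hp (h a (by simp)) (ih (fun i hi => h i (by simp [hi])))

theorem PDiv.ratCong {p k : ℕ} (hp : p.Prime) {x y : ℚ} (h : PDiv p k (x - y)) :
    RatCong p k x y := by
  haveI := Fact.mk hp
  by_cases hxy : x = y
  · exact Or.inl hxy
  right
  obtain ⟨a, d, hd, h⟩ := h
  have h0 : x - y ≠ 0 := sub_ne_zero.mpr hxy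
  have hd0 : (d : ℚ) ≠ 0 := by
    intro h0
    apply hd
    have : d = 0 := by exact_mod_cast h0
    simp [this]
  have hp0 : (p : ℚ) ≠ 0 := by exact_mod_cast hp.ne_zero
  have ha0 : (a : ℚ) ≠ 0 := by
    intro ha
    rw [ha, mul_zero] at h
    exact mul_ne_zero h0 hd0 h
  have hv := congrArg (padicValRat p) h
  rw [padicValRat.mul h0 hd0, padicValRat.mul (pow_ne_zero _ hp0) ha0, padicValRat.pow,
    padicValRat.self hp.one_lt, padicValRat.of_int, padicValRat.of_int,
    padicValInt.eq_zero_of_not_dvd hd] at hv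
  push_cast at hv
  have : (0 : ℤ) ≤ (padicValInt p a : ℤ) := by positivity
  linarith

theorem harmonic_pdiv {p : ℕ} (hp : p.Prime) (ε : ℕ) (h : ε < p) : PDiv p 0 (harmonic ε) := by
  unfold harmonic
  apply PDiv.sum hp
  intro i hi
  have hi := Finset.mem_range.mp hi
  have := PDiv.inv (p := p) ((i + 1 : ℕ) : ℤ) (by
    intro h1
    have := Nat.le_of_dvd (by omega) (Int.natCast_dvd_natCast.mp h1)
    omega)
  simpa using this

theorem dvd_choose_mul {p : ℕ} (hp : p.Prime) (b j : ℕ) (hj : ¬ p ∣ j) :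
    p ∣ (b * p).choose j := by
  rcases j with _ | j
  · simp at hj
  rcases Nat.eq_zero_or_pos (b * p) with h | h
  · rw [h]; simp
  obtain ⟨N, hN⟩ : ∃ N, b * p = N + 1 := ⟨b * p - 1, by omega⟩
  have h1 := Nat.add_one_mul_choose_eq N j
  rw [← hN] at h1
  have h2 : p ∣ (b * p).choose (j + 1) * (j + 1) := by
    rw [← h1]
    exact Dvd.dvd.mul_right (Dvd.intro_left b rfl) _
  exact (hp.dvd_mul.mp h2).resolve_right hj

theorem choose_mul_mul {p : ℕ} (hp : p.Prime) (b : ℕ) : ∀ k : ℕ,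
    (((b * p).choose (k * p) : ℕ) : ZMod (p ^ 2)) = ((b.choose k : ℕ) : ZMod (p ^ 2)) := by
  induction b with
  | zero =>
    intro k
    rcases k with _ | k
    · simp
    · rw [zero_mul, Nat.choose_eq_zero_of_lt (Nat.mul_pos (Nat.succ_pos k) hp.pos)]
      simp
  | succ b ih =>
    intro k
    rcases k with _ | k
    · simp
    have hpp := hp.pos
    rw [Nat.choose_succ_succ, Nat.cast_add, ← ih k, ← ih (k + 1),
      show (b + 1) * p = p + b * p by ring, Nat.add_choose_eq, Nat.cast_sum]
    rw [← Finset.sum_subset (s₁ := {(0, (k + 1) * p), (p, k * p)})]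
    · rw [Finset.sum_pair]
      · simp [add_comm]
      · intro h
        have := congrArg Prod.fst h
        simp at this
        omega
    · intro x hx
      simp only [Finset.mem_insert, Finset.mem_singleton] at hx
      rw [Finset.HasAntidiagonal.mem_antidiagonal]
      rcases hx with rfl | rfl
      · simp
      · simp; ring
    · rintro ⟨i, j⟩ hx hn
      rw [Finset.HasAntidiagonal.mem_antidiagonal] at hx
      simp only [Finset.mem_insert, Finset.mem_singleton, Prod.mk.injEq, not_or, not_and] at hn hx
      rw [ZMod.natCast_eq_zero_iff]
      show p ^ 2 ∣ p.choose i * (b * p).choose j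
      have hi0 : i ≠ 0 := by
        rintro rfl
        exact hn.1 rfl (by omega)
      have hip : i ≠ p := by
        rintro rfl
        apply hn.2 rfl
        have : (k + 1) * i = k * i + i := by ring
        omega
      rcases lt_or_gt_of_ne hip with hlt | hgt
      · rw [pow_two]
        apply mul_dvd_mul (hp.dvd_choose_self hi0 hlt)
        apply dvd_choose_mul hp
        intro hj
        have : p ∣ i := by
          rw [Nat.dvd_add_iff_left hj, hx]
          exact Dvd.intro_left _ rfl
        exact absurd (Nat.le_of_dvd (by omega) this) (by omega)
      · rw [Nat.choose_eq_zero_of_lt hgt]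
        simp

theorem choose_pdiv {p : ℕ} (hp : p.Prime) (b k : ℕ) (hk : k ≤ b) (ε : ℕ) : ε < p →
    PDiv p 2 (((b * p + ε).choose (k * p) : ℚ) -
      (b.choose k : ℚ) * (1 + p * k * harmonic ε)) := by
  induction ε with
  | zero =>
    intro _
    have h := choose_mul_mul hp b k
    have h' : ((((b.choose k : ℕ) : ℤ)) : ZMod (p ^ 2)) =
        ((((b * p).choose (k * p) : ℕ) : ℤ) : ZMod (p ^ 2)) := by
      push_cast; exact h.symm
    rw [ZMod.intCast_eq_intCast_iff_dvd_sub] at h'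
    obtain ⟨a, ha⟩ := h'
    refine ⟨a, 1, (Nat.prime_iff_prime_int.mp hp).not_dvd_one, ?_⟩
    have ha' : (((b * p).choose (k * p) : ℕ) : ℚ) - ((b.choose k : ℕ) : ℚ) = (p : ℚ) ^ 2 * a := by
      exact_mod_cast ha
    simp [← ha']
  | succ e ih =>
    intro he
    have ih := ih (by omega)
    have hH := harmonic_pdiv hp e (by omega)
    have hkp : k * p ≤ b * p := Nat.mul_le_mul_right p hk
    have hrec := Nat.add_one_mul_choose_eq
    have h1 : ((b * p + (e + 1)).choose (k * p)) * (b * p + (e + 1) - k * p) =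
        (b * p + e).choose (k * p) * (b * p + (e + 1)) := 
      (Nat.choose_mul_succ_eq (b * p + e) (k * p)).symm
    obtain ⟨c, rfl⟩ := Nat.exists_eq_add_of_le hk
    rw [show (k + c) * p + (e + 1) - k * p = c * p + (e + 1) by
      rw [add_mul]; omega] at h1
    have h2 : ((((k + c) * p + (e + 1)).choose (k * p) : ℕ) : ℚ) * (c * p + (e + 1)) =
        (((k + c) * p + e).choose (k * p) : ℕ) * ((k + c) * p + (e + 1)) := by
      exact_mod_cast h1
    have hu : (c * p + (e + 1) : ℚ) ≠ 0 := by positivity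
    have he0 : (e + 1 : ℚ) ≠ 0 := by positivity
    rw [harmonic_succ]
    set C' : ℚ := ((((k + c) * p + (e + 1)).choose (k * p) : ℕ) : ℚ)
    set C : ℚ := ((((k + c) * p + e).choose (k * p) : ℕ) : ℚ)
    set H := harmonic e
    set B : ℚ := (((k + c).choose k : ℕ) : ℚ) with hB
    have hnd : ∀ q : ℕ, ¬ ((p : ℤ) ∣ ((q * p + (e + 1) : ℕ) : ℤ)) := by
      intro q h
      have h := Int.natCast_dvd_natCast.mp h
      have h := (Nat.dvd_add_iff_right (Dvd.intro_left q rfl : p ∣ q * p)).mpr h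
      have := Nat.le_of_dvd (by omega) h
      omega
    have hui := PDiv.inv _ (hnd c)
    have hei := PDiv.inv _ (hnd 0)
    have key : C' - B * (1 + p * k * (H + ((e + 1 : ℕ) : ℚ)⁻¹)) =
        ((C - B * (1 + p * k * H)) * ((((k + c) * p + (e + 1) : ℕ) : ℤ) : ℚ)
          + ((p ^ 2 : ℕ) : ℤ) * ((((k + c).choose k * k : ℕ) : ℤ) *
             (((k : ℤ) : ℚ) * H + ((-c : ℤ) : ℚ) * (((0 * p + (e + 1) : ℕ) : ℤ) : ℚ)⁻¹)))
          * (((c * p + (e + 1) : ℕ) : ℤ) : ℚ)⁻¹ := by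
      push_cast
      rw [← hB, zero_mul, zero_add, eq_mul_inv_iff_mul_eq₀ hu, sub_mul, h2]
      field_simp
      ring
    rw [key]
    have hp2 : PDiv p 2 ((((p ^ 2 : ℕ) : ℤ)) : ℚ) :=
      ⟨1, 1, (Nat.prime_iff_prime_int.mp hp).not_dvd_one, by push_cast; ring⟩
    refine PDiv.mul hp (k := 2) (l := 0) (PDiv.add hp ?_ ?_) hui
    · exact PDiv.mul hp (k := 2) (l := 0) ih (PDiv.int hp _)
    · refine PDiv.mul hp (k := 2) (l := 0) hp2 (PDiv.mul hp (k := 0) (l := 0) (PDiv.int hp _) ?_)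
      exact PDiv.add hp (PDiv.mul hp (k := 0) (l := 0) (PDiv.int hp _) hH)
        (PDiv.mul hp (k := 0) (l := 0) (PDiv.int hp _) hei)

theorem stir_eq (t b : ℕ) : ((b + 1).factorial : ℚ) * stir t (b + 1) - ((b : ℚ) + 1) ^ t =
    ∑ k ∈ Finset.range (b + 1),
      (-1 : ℚ) ^ (b + 1 - k) * ((b + 1).choose k : ℚ) * (k : ℚ) ^ t := by
  unfold stir
  rw [← mul_assoc, mul_one_div_cancel (by positivity), one_mul, ← Finset.sum_range_reflect,
    Finset.sum_range_succ]
  have : ∀ k ∈ Finset.range (b + 1), (-1 : ℚ) ^ (b + 1 + 1 - 1 - k) *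
      ((b + 1).choose (b + 1 + 1 - 1 - k) : ℚ) *
      ((b + 1 - (b + 1 + 1 - 1 - k) : ℕ) : ℚ) ^ t =
      (-1 : ℚ) ^ (b + 1 - k) * ((b + 1).choose k : ℚ) * (k : ℚ) ^ t := by
    intro k hk
    have hk := Finset.mem_range.mp hk
    rw [show b + 1 + 1 - 1 - k = b + 1 - k by omega, Nat.choose_symm (by omega),
      show b + 1 - (b + 1 - k) = k by omega]
  rw [Finset.sum_congr rfl this]
  simp

theorem sum_multiples_of_p_mod_p_sq (p : ℕ) (hp : p.Prime) (hp3 : 3 ≤ p)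
    (b ε : ℕ) (hb : b ≤ p - 2) (hε : ε ≤ p - 1) (m : ℕ) (hm : 1 ≤ m) :
    RatCong p 2
      (∑ k ∈ Finset.range (b + 1),
        (-1 : ℚ) ^ (b * p + ε - k * p) * ((k : ℚ) ^ m / ((b : ℚ) + 1 - (k : ℚ))) *
          ((b * p + ε).choose (k * p) : ℚ))
      (((-1 : ℚ) ^ (b * p + ε) / ((b : ℚ) + 1)) * (-1 : ℚ) ^ (b + 1) *
        (((b + 1).factorial : ℚ) * stir m (b + 1) +
          (p : ℚ) * harmonic ε * ((b + 1).factorial : ℚ) * stir (m + 1) (b + 1) -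
          ((b : ℚ) + 1) ^ m - (p : ℚ) * harmonic ε * ((b : ℚ) + 1) ^ (m + 1))) := by
  have hp2 := hp.two_le
  apply PDiv.ratCong hp
  have hodd : Odd p := hp.odd_of_ne_two (by omega)
  set H := harmonic ε
  have hR : (((b + 1).factorial : ℚ) * stir m (b + 1) +
          (p : ℚ) * H * ((b + 1).factorial : ℚ) * stir (m + 1) (b + 1) -
          ((b : ℚ) + 1) ^ m - (p : ℚ) * H * ((b : ℚ) + 1) ^ (m + 1)) =
      (((b + 1).factorial : ℚ) * stir m (b + 1) - ((b : ℚ) + 1) ^ m) + 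
      (p : ℚ) * H * (((b + 1).factorial : ℚ) * stir (m + 1) (b + 1) - ((b : ℚ) + 1) ^ (m + 1)) := by
    ring
  rw [hR, stir_eq, stir_eq, Finset.mul_sum, ← Finset.sum_add_distrib, Finset.mul_sum,
    ← Finset.sum_sub_distrib]
  apply PDiv.sum hp
  intro k hk
  have hk := Finset.mem_range.mp hk
  have hC := choose_pdiv hp b k (by omega) ε (by omega)
  obtain ⟨c, rfl⟩ := Nat.exists_eq_add_of_le (show k ≤ b by omega)
  have hc : ¬ ((p : ℤ) ∣ ((c + 1 : ℕ) : ℤ)) := by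
    intro h
    have := Nat.le_of_dvd (by omega) (Int.natCast_dvd_natCast.mp h)
    omega
  have hci := PDiv.inv _ hc
  have hch : ((k + c + 1).choose k : ℚ) * (c + 1) = ((k + c).choose k : ℚ) * (k + c + 1) := by
    have := Nat.choose_mul_succ_eq (k + c) k
    rw [show k + c + 1 - k = c + 1 by omega] at this
    exact_mod_cast this.symm
  have hs1 : (-1 : ℚ) ^ ((k + c) * p + ε - k * p) = (-1) ^ (c + ε) := by
    rw [show (k + c) * p + ε - k * p = c * p + ε by rw [add_mul]; omega, pow_add, pow_add,
      mul_comm c p, pow_mul, hodd.neg_one_pow]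
  have hs2 : (-1 : ℚ) ^ ((k + c) * p + ε) * (-1) ^ (k + c + 1) * (-1) ^ (k + c + 1 - k)
      = (-1) ^ (c + ε) := by
    rw [show k + c + 1 - k = c + 1 by omega, pow_add, pow_add, mul_comm (k + c) p, pow_mul,
      hodd.neg_one_pow]
    have h1 : ((-1 : ℚ) ^ k) * (-1) ^ k = 1 := by rw [← mul_pow]; simp
    have h2 : ((-1 : ℚ) ^ c) * (-1) ^ c = 1 := by rw [← mul_pow]; simp
    simp only [pow_add, pow_one]
    linear_combination ((-1 : ℚ) ^ c * (-1) ^ ε) * ((-1 : ℚ) ^ c * (-1) ^ c * h1 + h2)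
  have hc0 : (c + 1 : ℚ) ≠ 0 := by positivity
  have hb0 : (k + c + 1 : ℚ) ≠ 0 := by positivity
  have hch2 : ((k + c + 1).choose k : ℚ) = ((k + c).choose k : ℚ) * (k + c + 1) / (c + 1) := by
    rw [eq_div_iff hc0, hch]
  have key := PDiv.mul hp (k := 2) (l := 0) hC (PDiv.mul hp (k := 0) (l := 0)
    (PDiv.int hp ((-1) ^ (c + ε) * (k : ℤ) ^ m)) hci)
  convert key using 1
  rw [hs1, hch2]
  push_cast
  rw [show (k : ℚ) + c + 1 - k = c + 1 by ring, ← hs2]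
  field_simp
  ring
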